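/- The class of languages recognized by high-level TOPL automata is not closed under complementation: there exist an arity n and a hl-TOPL automaton A over Σ = V^n such that no hl-TOPL automaton B satisfies L(B) = Σ* \ L(A). -/

import Mathlib

namespace Topl

/-- Guards over `m` registers and letters that are `n`-tuples. -/
inductive Guard (m n : ℕ) : Type
  | eq : Fin m → Fin n → Guard m n
  | neq : Fin m → Fin n → Guard m n
  | tt : Guard m n
  | and : Guard m n → Guard m n → Guard m n
  deriving DecidableEq

/-- Actions over `m` registers and letters that are `n`-tuples. -/
inductive Action (m n : ℕ) : Type
  | nop : Action m n
  | set : Fin m → Fin n → Action m n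
  | seq : Action m n → Action m n → Action m n
  deriving DecidableEq

/-- Satisfaction of a guard by a store `s` and a letter `ℓ`. -/
def Guard.Sat {V : Type} {m n : ℕ} (s : Fin m → V) (ℓ : Fin n → V) : Guard m n → Prop
  | .eq i j => s i = ℓ j
  | .neq i j => s i ≠ ℓ j
  | .tt => True
  | .and g₁ g₂ => Guard.Sat s ℓ g₁ ∧ Guard.Sat s ℓ g₂

/-- The store transformation of an action on input letter `ℓ`:
`nop(ℓ)(s) = s`, `(set i := j)(ℓ)(s) = s[i ↦ ℓ(j)]`, `(a₁;a₂)(ℓ) = a₁(ℓ) ∘ a₂(ℓ)`. -/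
def Action.run {V : Type} {m n : ℕ} (ℓ : Fin n → V) : Action m n → (Fin m → V) → (Fin m → V)
  | .nop, s => s
  | .set i j, s => Function.update s i (ℓ j)
  | .seq a₁ a₂, s => Action.run ℓ a₁ (Action.run ℓ a₂ s)

/-- A TOPL automaton with `m` registers over `n`-tuples, whose set of states is `Fin k`. -/
structure TOPL (V : Type) (m n k : ℕ) where
  q₀ : Fin k
  s₀ : Fin m → V
  δ : Finset (Fin k × (Guard m n × Action m n) × Fin k)
  F : Finset (Fin k)

namespace TOPL

variable {V : Type} {m n k : ℕ}

/-- One edge of the configuration graph, labelled by a letter. -/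
def Step (A : TOPL V m n k) (x₁ : Fin k × (Fin m → V)) (ℓ : Fin n → V)
    (x₂ : Fin k × (Fin m → V)) : Prop :=
  ∃ g a, (x₁.1, (g, a), x₂.1) ∈ A.δ ∧ Guard.Sat x₁.2 ℓ g ∧ Action.run ℓ a x₁.2 = x₂.2

/-- Walks in the configuration graph, labelled by words. -/
inductive Reach (A : TOPL V m n k) :
    Fin k × (Fin m → V) → List (Fin n → V) → Fin k × (Fin m → V) → Prop
  | nil (x) : Reach A x [] x
  | cons {x₁ x₂ x₃ ℓ w} : A.Step x₁ ℓ x₂ → Reach A x₂ w x₃ → Reach A x₁ (ℓ :: w) x₃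

/-- The language of a TOPL automaton: words labelling walks from the initial
configuration to a configuration whose state is final. -/
def Lang (A : TOPL V m n k) : Set (List (Fin n → V)) :=
  { w | ∃ x, A.Reach (A.q₀, A.s₀) w x ∧ x.1 ∈ A.F }

end TOPL

/-- A high-level TOPL automaton: transitions are labelled by finite sequences of
guard–action pairs. -/
structure HlTOPL (V : Type) (m n k : ℕ) where
  q₀ : Fin k
  s₀ : Fin m → V
  δ : Finset (Fin k × List (Guard m n × Action m n) × Fin k)
  F : Finset (Fin k)

namespace HlTOPL

variable {V : Type} {m n k : ℕ}

/-- `SeqAccept s gas w s'` holds when the TOPL automaton `T(s; gas)` accepts the word `w`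
ending with store `s'`. -/
inductive SeqAccept {V : Type} {m n : ℕ} :
    (Fin m → V) → List (Guard m n × Action m n) → List (Fin n → V) → (Fin m → V) → Prop
  | nil (s) : SeqAccept s [] [] s
  | cons {s s' g a gas ℓ w} : Guard.Sat s ℓ g → SeqAccept (Action.run ℓ a s) gas w s' →
      SeqAccept s ((g, a) :: gas) (ℓ :: w) s'

/-- A standard transition starts from the hl-configuration `(x, v)`. -/
def StdFrom (A : HlTOPL V m n k) (x : Fin k × (Fin m → V)) (v : List (Fin n → V)) : Prop :=
  ∃ q₂ s₂ gas u u', v = u ++ u' ∧ (x.1, gas, q₂) ∈ A.δ ∧ SeqAccept x.2 gas u s₂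

/-- One edge of the hl-configuration graph: a standard transition or a skip transition. -/
inductive HlStep (A : HlTOPL V m n k) :
    (Fin k × (Fin m → V)) × List (Fin n → V) → List (Fin n → V) →
    (Fin k × (Fin m → V)) × List (Fin n → V) → Prop
  | std {q₁ s₁ q₂ s₂ gas w w'} : (q₁, gas, q₂) ∈ A.δ → SeqAccept s₁ gas w s₂ →
      HlStep A ((q₁, s₁), w ++ w') w ((q₂, s₂), w')
  | skip {q s ℓ w} : ¬ A.StdFrom (q, s) (ℓ :: w) → HlStep A ((q, s), ℓ :: w) [ℓ] ((q, s), w)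

/-- Paths in the hl-configuration graph, labelled by the concatenation of the step labels. -/
inductive Path (A : HlTOPL V m n k) :
    (Fin k × (Fin m → V)) × List (Fin n → V) → List (Fin n → V) →
    (Fin k × (Fin m → V)) × List (Fin n → V) → Prop
  | nil (y) : Path A y [] y
  | cons {y₁ y₂ y₃ u w} : A.HlStep y₁ u y₂ → Path A y₂ w y₃ → Path A y₁ (u ++ w) y₃

/-- The language of a high-level TOPL automaton: words labelling paths from an initial
hl-configuration to a final one. -/
def Lang (A : HlTOPL V m n k) : Set (List (Fin n → V)) :=
  { w | ∃ (w₀ : List (Fin n → V)) (q : Fin k) (s : Fin m → V),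
      A.Path ((A.q₀, A.s₀), w₀) w ((q, s), ([] : List (Fin n → V))) ∧ q ∈ A.F }

end HlTOPL

theorem Guard.sat_map {V : Type} {m n : ℕ} (π : Equiv.Perm V) (s : Fin m → V) (ℓ : Fin n → V)
    (g : Guard m n) : Guard.Sat (π ∘ s) (π ∘ ℓ) g ↔ Guard.Sat s ℓ g := by
  induction g with
  | eq i j => simp [Guard.Sat]
  | neq i j => simp [Guard.Sat]
  | tt => simp [Guard.Sat]
  | and g₁ g₂ h₁ h₂ => simp [Guard.Sat, h₁, h₂]

theorem Action.run_map {V : Type} {m n : ℕ} (π : Equiv.Perm V) (ℓ : Fin n → V) (a : Action m n)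
    (s : Fin m → V) : Action.run (π ∘ ℓ) a (π ∘ s) = π ∘ Action.run ℓ a s := by
  induction a generalizing s with
  | nop => rfl
  | set i j => simp [Action.run, Function.comp_update]
  | seq a₁ a₂ h₁ h₂ => simp [Action.run, h₁, h₂]

/-- Every register of the new store holds an old value or a component of the letter read. -/
theorem Action.run_mem {V : Type} {m n : ℕ} (ℓ : Fin n → V) (a : Action m n) (s : Fin m → V)
    (i : Fin m) : (∃ i', Action.run ℓ a s i = s i') ∨ ∃ j, Action.run ℓ a s i = ℓ j := by
  induction a generalizing s i with
  | nop => exact .inl ⟨i, rfl⟩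
  | set i₀ j =>
    by_cases h : i = i₀
    · subst h
      exact .inr ⟨j, by simp [Action.run]⟩
    · exact .inl ⟨i, by simp [Action.run, h]⟩
  | seq a₁ a₂ h₁ h₂ =>
    rcases h₁ (Action.run ℓ a₂ s) i with ⟨i', h⟩ | ⟨j, h⟩
    · rcases h₂ s i' with ⟨i'', h'⟩ | ⟨j, h'⟩
      · exact .inl ⟨i'', h.trans h'⟩
      · exact .inr ⟨j, h.trans h'⟩
    · exact .inr ⟨j, h⟩

namespace HlTOPL

variable {V : Type} {m n k : ℕ}

/-- The action of a permutation of the values on words. -/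
abbrev mapWord (π : Equiv.Perm V) (w : List (Fin n → V)) : List (Fin n → V) :=
  w.map fun ℓ => π ∘ ℓ

theorem mapWord_symm (π : Equiv.Perm V) (w : List (Fin n → V)) :
    mapWord π.symm (mapWord π w) = w := by
  simp [mapWord, Function.comp_def]

theorem SeqAccept.map (π : Equiv.Perm V) {s s' : Fin m → V} {gas} {w : List (Fin n → V)}
    (h : SeqAccept s gas w s') : SeqAccept (π ∘ s) gas (mapWord π w) (π ∘ s') := by
  induction h with
  | nil s => exact .nil _
  | cons hg _ ih => exact .cons ((Guard.sat_map π _ _ _).2 hg) (by rwa [Action.run_map])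

theorem SeqAccept.length_eq {s s' : Fin m → V} {gas} {w : List (Fin n → V)}
    (h : SeqAccept s gas w s') : w.length = gas.length := by
  induction h with
  | nil s => rfl
  | cons _ _ ih => simp [ih]

theorem SeqAccept.store_mem {s s' : Fin m → V} {gas} {w : List (Fin n → V)}
    (h : SeqAccept s gas w s') (i : Fin m) :
    (∃ i', s' i = s i') ∨ ∃ ℓ ∈ w, ∃ j, s' i = ℓ j := by
  induction h generalizing i with
  | nil s => exact .inl ⟨i, rfl⟩
  | @cons s _ _ a _ ℓ _ _ _ ih =>
    rcases ih i with ⟨i', h⟩ | ⟨ℓ', hℓ, j, h⟩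
    · rcases Action.run_mem ℓ a s i' with ⟨i'', h'⟩ | ⟨j, h'⟩
      · exact .inl ⟨i'', h.trans h'⟩
      · exact .inr ⟨ℓ, by simp, j, h.trans h'⟩
    · exact .inr ⟨ℓ', by simp [hℓ], j, h⟩

theorem StdFrom.map {A : HlTOPL V m n k} (π : Equiv.Perm V) {q s v} (h : A.StdFrom (q, s) v) :
    A.StdFrom (q, π ∘ s) (mapWord π v) := by
  obtain ⟨q₂, s₂, gas, u, u', rfl, hδ, hs⟩ := h
  exact ⟨q₂, π ∘ s₂, gas, mapWord π u, mapWord π u', by simp, hδ, hs.map π⟩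

theorem stdFrom_map_iff {A : HlTOPL V m n k} (π : Equiv.Perm V) {q s v} :
    A.StdFrom (q, π ∘ s) (mapWord π v) ↔ A.StdFrom (q, s) v := by
  refine ⟨fun h => ?_, StdFrom.map π⟩
  have h' := h.map π.symm
  rw [mapWord_symm] at h'
  simpa [← Function.comp_assoc] using h'

theorem HlStep.map {A : HlTOPL V m n k} (π : Equiv.Perm V) {y₁ y₂ u} (h : A.HlStep y₁ u y₂) :
    A.HlStep ((y₁.1.1, π ∘ y₁.1.2), mapWord π y₁.2) (mapWord π u)
      ((y₂.1.1, π ∘ y₂.1.2), mapWord π y₂.2) := by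
  cases h with
  | std hδ hs =>
    simp only [mapWord, List.map_append]
    exact .std hδ (hs.map π)
  | skip h => exact .skip (mt (stdFrom_map_iff π (v := _ :: _)).1 h)

theorem Path.map {A : HlTOPL V m n k} (π : Equiv.Perm V) {y₁ y₂ u} (h : A.Path y₁ u y₂) :
    A.Path ((y₁.1.1, π ∘ y₁.1.2), mapWord π y₁.2) (mapWord π u)
      ((y₂.1.1, π ∘ y₂.1.2), mapWord π y₂.2) := by
  induction h with
  | nil y => exact .nil _
  | cons hs _ ih =>
    simp only [mapWord, List.map_append]
    exact .cons (hs.map π) ih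

theorem HlStep.eq_append {A : HlTOPL V m n k} {y₁ y₂ u} (h : A.HlStep y₁ u y₂) :
    y₁.2 = u ++ y₂.2 := by
  cases h <;> rfl

theorem Path.eq_append {A : HlTOPL V m n k} {y₁ y₂ u} (h : A.Path y₁ u y₂) :
    y₁.2 = u ++ y₂.2 := by
  induction h with
  | nil y => rfl
  | cons hs _ ih => rw [hs.eq_append, ih, List.append_assoc]

/-- The word `v` is accepted when starting from the configuration `(q, s)`. -/
def Accepts (A : HlTOPL V m n k) (q : Fin k) (s : Fin m → V) (v : List (Fin n → V)) : Prop :=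
  ∃ q' s', A.Path ((q, s), v) v ((q', s'), []) ∧ q' ∈ A.F

theorem mem_lang_iff {A : HlTOPL V m n k} {w} : w ∈ A.Lang ↔ A.Accepts A.q₀ A.s₀ w := by
  constructor
  · rintro ⟨w₀, q, s, h, hq⟩
    obtain rfl : w₀ = w := by simpa using h.eq_append
    exact ⟨q, s, h, hq⟩
  · rintro ⟨q, s, h, hq⟩
    exact ⟨w, q, s, h, hq⟩

theorem Accepts.map {A : HlTOPL V m n k} (π : Equiv.Perm V) {q s v} (h : A.Accepts q s v) :
    A.Accepts q (π ∘ s) (mapWord π v) := by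
  obtain ⟨q', s', h, hq⟩ := h
  exact ⟨q', π ∘ s', h.map π, hq⟩

theorem Accepts.step {A : HlTOPL V m n k} {q q' s s' u v}
    (hs : A.HlStep ((q, s), u ++ v) u ((q', s'), v)) (h : A.Accepts q' s' v) :
    A.Accepts q s (u ++ v) := by
  obtain ⟨q'', s'', h, hq⟩ := h
  exact ⟨q'', s'', .cons hs h, hq⟩

/-- A bound on the number of letters read or inspected by one step. -/
def window (A : HlTOPL V m n k) : ℕ := A.δ.sup (fun t => t.2.1.length) + 1

theorem length_le_window {A : HlTOPL V m n k} {q gas q'} (h : (q, gas, q') ∈ A.δ) :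
    gas.length ≤ A.window :=
  (Finset.le_sup (f := fun t => t.2.1.length) h).trans (Nat.le_succ _)

theorem HlStep.length_le {A : HlTOPL V m n k} {y₁ y₂ u} (h : A.HlStep y₁ u y₂) :
    u.length ≤ A.window := by
  cases h with
  | std hδ hs => exact hs.length_eq.trans_le (length_le_window hδ)
  | skip h => simp [window]

theorem HlStep.store_mem {A : HlTOPL V m n k} {y₁ y₂ u} (h : A.HlStep y₁ u y₂) (i : Fin m) :
    (∃ i', y₂.1.2 i = y₁.1.2 i') ∨ ∃ ℓ ∈ u, ∃ j, y₂.1.2 i = ℓ j := by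
  cases h with
  | std hδ hs => exact hs.store_mem i
  | skip h => exact .inl ⟨i, rfl⟩

theorem StdFrom.of_take_eq {A : HlTOPL V m n k} {x v v'} (h : A.StdFrom x v)
    (hv : v.take A.window = v'.take A.window) : A.StdFrom x v' := by
  obtain ⟨q₂, s₂, gas, u, u', rfl, hδ, hs⟩ := h
  have hu : u.length ≤ A.window := hs.length_eq.trans_le (length_le_window hδ)
  have hp : u <+: (u ++ u').take A.window :=
    List.prefix_take_iff.2 ⟨List.prefix_append u u', hu⟩
  rw [hv] at hp
  obtain ⟨t, rfl⟩ := hp.trans (List.take_prefix _ _)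
  exact ⟨q₂, s₂, gas, u, t, rfl, hδ, hs⟩

theorem take_append_congr {α : Type*} {d : ℕ} (u : List α) {v v' : List α}
    (h : v.take d = v'.take d) : (u ++ v).take d = (u ++ v').take d := by
  have key : v.take (d - u.length) = v'.take (d - u.length) := by
    have := congrArg (List.take (d - u.length)) h
    simpa [List.take_take] using this
  rw [List.take_append, List.take_append, key]

/-- A step does not depend on the input beyond the window. -/
theorem HlStep.congr_suffix {A : HlTOPL V m n k} {x₁ x₂ u v v'}
    (h : A.HlStep (x₁, u ++ v) u (x₂, v)) (hv : v.take A.window = v'.take A.window) :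
    A.HlStep (x₁, u ++ v') u (x₂, v') := by
  generalize hy : u ++ v = t at h
  cases h with
  | std hδ hs => exact .std hδ hs
  | skip h => exact .skip fun h' => h (h'.of_take_eq (take_append_congr [_] hv.symm))

/-- With more than `m` distinct letters consumed, one of them is in no register, and it can
replace a letter beyond the window. -/
theorem Accepts.exists_swap {A : HlTOPL V m 1 k} {q s} {p v : List (Fin 1 → V)}
    (h : A.Accepts q s v) (hnd : (p ++ v).Nodup) (hs : ∀ i, ∀ ℓ ∈ v, s i ≠ ℓ 0)
    (hp : m < p.length) (hv : A.window < v.length) :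
    ∃ v', A.Accepts q s v' ∧ v.take A.window = v'.take A.window ∧ ¬ (p ++ v').Nodup := by
  classical
  obtain ⟨hpn, hvn, hdisj⟩ := List.nodup_append.1 hnd
  obtain ⟨a, hap, has⟩ : ∃ a ∈ p, ∀ i, s i ≠ a 0 := by
    have hcard : (Finset.univ.image fun i => (fun _ => s i : Fin 1 → V)).card
        < p.toFinset.card := by
      rw [List.toFinset_card_of_nodup hpn]
      exact (Finset.card_image_le.trans_eq (by simp)).trans_lt hp
    obtain ⟨a, ha, ha'⟩ := Finset.exists_mem_notMem_of_card_lt_card hcard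
    refine ⟨a, List.mem_toFinset.1 ha, fun i hi => ha' ?_⟩
    refine Finset.mem_image.2 ⟨i, Finset.mem_univ _, ?_⟩
    ext j
    rw [Subsingleton.elim j 0, hi]
  have hne : ∀ {x y : Fin 1 → V}, x ≠ y → x 0 ≠ y 0 := fun hxy h0 => hxy (by
    ext j
    rw [Subsingleton.elim j 0, h0])
  set b := v[A.window] with hb
  have hbv : b ∈ v := List.getElem_mem hv
  have hbt : b ∉ v.take A.window := by
    have hsplit : v = v.take A.window ++ b :: v.drop (A.window + 1) := by
      rw [hb, List.getElem_cons_drop, List.take_append_drop]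
    have := hsplit ▸ hvn
    exact fun hmem => (List.nodup_append.1 this).2.2 b hmem b (by simp) rfl
  refine ⟨mapWord (Equiv.swap (a 0) (b 0)) v, ?_, ?_, ?_⟩
  · have h' := h.map (Equiv.swap (a 0) (b 0))
    rwa [show Equiv.swap (a 0) (b 0) ∘ s = s from
      funext fun i => Equiv.swap_apply_of_ne_of_ne (has i) (hs i b hbv)] at h'
  · rw [mapWord, ← List.map_take]
    refine ((List.map_congr_left fun ℓ hℓ => ?_).trans (List.map_id _)).symm
    have hℓv := List.mem_of_mem_take hℓ
    ext j
    rw [Subsingleton.elim j 0]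
    exact Equiv.swap_apply_of_ne_of_ne (hne fun h => hdisj a hap ℓ hℓv h.symm)
      (hne fun h => hbt (h ▸ hℓ))
  · intro hn
    refine (List.nodup_append.1 hn).2.2 a hap a (List.mem_map.2 ⟨b, hbv, ?_⟩) rfl
    ext j
    simp [Subsingleton.elim j 0]

theorem Path.exists_accepts_not_nodup {A : HlTOPL V m 1 k} {y₁ y₂ w} (h : A.Path y₁ w y₂)
    (hF : y₂.1.1 ∈ A.F) (hw : y₂.2 = []) (p : List (Fin 1 → V)) (hnd : (p ++ y₁.2).Nodup)
    (hs : ∀ i, ∀ ℓ ∈ y₁.2, y₁.1.2 i ≠ ℓ 0) (hp : p.length ≤ m + A.window)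
    (hlen : m + 2 * A.window < p.length + y₁.2.length) :
    ∃ v', A.Accepts y₁.1.1 y₁.1.2 v' ∧ y₁.2.take A.window = v'.take A.window ∧
      ¬ (p ++ v').Nodup := by
  induction h generalizing p with
  | nil y =>
    rw [hw, List.length_nil] at hlen
    omega
  | @cons y₁ y₂ y₃ u w hstep hpath ih =>
    by_cases hmp : m < p.length
    · refine Accepts.exists_swap ?_ hnd hs hmp (by omega)
      obtain ⟨⟨q', s'⟩, v'⟩ := y₃
      subst hw
      have h := Path.cons hstep hpath
      have he := h.eq_append
      rw [List.append_nil] at he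
      exact ⟨q', s', by convert h, hF⟩
    · obtain ⟨⟨q₁, s₁⟩, v₁⟩ := y₁
      obtain ⟨⟨q₂, s₂⟩, v₂⟩ := y₂
      obtain rfl : v₁ = u ++ v₂ := hstep.eq_append
      have hu := hstep.length_le
      simp only [List.length_append] at hlen
      have hnd' : ((p ++ u) ++ v₂).Nodup := by rwa [List.append_assoc]
      have hs₂ : ∀ i, ∀ ℓ ∈ v₂, s₂ i ≠ ℓ 0 := by
        intro i ℓ hℓ he
        rcases hstep.store_mem i with ⟨i', h⟩ | ⟨ℓ', hℓ', j, h⟩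
        · exact hs i' ℓ (by simp [hℓ]) (h.symm.trans he)
        · refine (List.nodup_append.1 hnd').2.2 ℓ' (by simp [hℓ']) ℓ hℓ ?_
          ext j'
          rw [Subsingleton.elim j' 0, ← he, ← Subsingleton.elim j 0]
          exact h.symm
      obtain ⟨v', hacc, htake, hnot⟩ := ih hF hw (p ++ u) hnd' hs₂
        (by rw [List.length_append]; omega) (by simp only [List.length_append]; omega)
      exact ⟨u ++ v', hacc.step (hstep.congr_suffix htake), take_append_congr u htake,
        by rwa [← List.append_assoc]⟩

/-- Over one-component letters, distinctness of letters is not recognizable. -/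
theorem lang_ne_nodup [Infinite V] (B : HlTOPL V m 1 k) : B.Lang ≠ {w | w.Nodup} := by
  intro hB
  obtain ⟨t, ht, hcard⟩ := ((Set.finite_range B.s₀).infinite_compl).exists_subset_card_eq
    (m + 2 * B.window + 1)
  have hinj : Function.Injective fun x : V => (fun _ => x : Fin 1 → V) :=
    fun x y hxy => congrFun hxy 0
  set v : List (Fin 1 → V) := t.toList.map fun x _ => x with hv
  have hvn : v.Nodup := t.nodup_toList.map hinj
  have hlen : v.length = m + 2 * B.window + 1 := by simp [hv, hcard]
  have hmem : v ∈ B.Lang := hB ▸ hvn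
  obtain ⟨q, s, hp, hq⟩ := mem_lang_iff.1 hmem
  obtain ⟨v', hacc, -, hnot⟩ := hp.exists_accepts_not_nodup hq rfl [] hvn
    (fun i ℓ hℓ he => by
      obtain ⟨x, hx, rfl⟩ := List.mem_map.1 hℓ
      exact ht (Finset.mem_coe.2 (Finset.mem_toList.1 hx)) ⟨i, he⟩)
    (Nat.zero_le _) (by simp only [hlen, List.length_nil]; omega)
  have : v' ∈ B.Lang := mem_lang_iff.2 hacc
  rw [hB] at this
  exact hnot this

/-- Guess a letter, store it, and wait for its second occurrence. -/
def repetition (x : V) : HlTOPL V 1 1 3 where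
  q₀ := 0
  s₀ := fun _ => x
  δ := {(0, [(.tt, .nop)], 0), (0, [(.tt, .set 0 0)], 1), (1, [(.tt, .nop)], 1),
    (1, [(.eq 0 0, .nop)], 2), (2, [(.tt, .nop)], 2)}
  F := {2}

theorem Accepts.cons_of_mem {A : HlTOPL V m n k} {q q' : Fin k} {s : Fin m → V} {g a ℓ v}
    (hδ : (q, [(g, a)], q') ∈ A.δ) (hg : Guard.Sat s ℓ g)
    (h : A.Accepts q' (Action.run ℓ a s) v) : A.Accepts q s (ℓ :: v) :=
  h.step (u := [ℓ]) (.std hδ (.cons hg (.nil _)))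

theorem run_set_eq (ℓ s : Fin 1 → V) : Action.run ℓ (.set 0 0) s = ℓ := by
  ext j
  simp [Action.run, Subsingleton.elim j 0]

theorem repetition_accepts_two (x : V) (s : Fin 1 → V) (v) :
    (repetition x).Accepts 2 s v := by
  induction v with
  | nil => exact ⟨2, s, .nil _, by simp [repetition]⟩
  | cons ℓ v ih => exact .cons_of_mem (g := .tt) (a := .nop) (by simp [repetition]) trivial ih

theorem repetition_accepts_one (x : V) (ℓ : Fin 1 → V) {v} (h : ℓ ∈ v) :
    (repetition x).Accepts 1 ℓ v := by
  induction v with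
  | nil => simp at h
  | cons ℓ' v ih =>
    rcases List.mem_cons.1 h with rfl | h
    · exact .cons_of_mem (g := .eq 0 0) (a := .nop) (by simp [repetition]) rfl
        (repetition_accepts_two ..)
    · exact .cons_of_mem (g := .tt) (a := .nop) (by simp [repetition]) trivial (ih h)

theorem repetition_accepts_zero (x : V) (s : Fin 1 → V) {v} (h : ¬ v.Nodup) :
    (repetition x).Accepts 0 s v := by
  induction v with
  | nil => simp at h
  | cons ℓ v ih =>
    by_cases hℓ : ℓ ∈ v
    · refine .cons_of_mem (q' := 1) (g := .tt) (a := .set 0 0) (by simp [repetition]) trivial ?_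
      rw [run_set_eq]
      exact repetition_accepts_one x ℓ hℓ
    · refine .cons_of_mem (g := .tt) (a := .nop) (by simp [repetition]) trivial (ih ?_)
      simpa [List.nodup_cons, hℓ] using h

theorem repetition_path (x : V) {y₁ y₂ w} (h : (repetition x).Path y₁ w y₂) (h₂ : y₂.1.1 = 2)
    (hnd : y₁.2.Nodup) : y₁.1.1 ≠ 0 ∧ (y₁.1.1 = 1 → y₁.1.2 ∈ y₁.2) := by
  induction h with
  | nil y => simp [h₂]
  | @cons y₁ y₂ y₃ u w hstep _ ih =>
    cases hstep with
    | skip h =>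
      obtain ⟨h0, h1⟩ := ih h₂ hnd.of_cons
      exact ⟨h0, fun h => List.mem_cons_of_mem _ (h1 h)⟩
    | std hδ hs =>
      obtain ⟨h0, h1⟩ := ih h₂ (List.nodup_append.1 hnd).2.1
      simp only [repetition, Finset.mem_insert, Finset.mem_singleton, Prod.mk.injEq] at hδ
      rcases hδ with ⟨rfl, rfl, rfl⟩ | ⟨rfl, rfl, rfl⟩ | ⟨rfl, rfl, rfl⟩ | ⟨rfl, rfl, rfl⟩ |
        ⟨rfl, rfl, rfl⟩ <;> obtain _ | ⟨hg, ⟨⟩⟩ := hs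
      · exact absurd rfl h0
      · have hmem := h1 rfl
        rw [run_set_eq] at hmem
        exact absurd hmem (List.nodup_cons.1 hnd).1
      · exact ⟨by simp, fun _ => List.mem_cons_of_mem _ (h1 rfl)⟩
      · refine ⟨by simp, fun _ => List.mem_cons.2 (.inl ?_)⟩
        ext j
        rw [Subsingleton.elim j 0]
        exact hg
      · simp

theorem lang_repetition (x : V) : (repetition x).Lang = {w | w.Nodup}ᶜ := by
  ext w
  refine mem_lang_iff.trans ⟨fun ⟨q, s, h, hq⟩ hnd => ?_, repetition_accepts_zero x _⟩
  exact (repetition_path x h (by simpa [repetition] using hq) hnd).1 rfl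

end HlTOPL

/-- hl-TOPL-recognizable languages are not closed under complementation: there are an arity
`n` and a hl-TOPL automaton `A` over `V^n` whose complement language `Σ* \ L(A)` is
recognized by no hl-TOPL automaton. -/
theorem hlTopl_not_closed_under_complement (V : Type) [Infinite V] :
    ∃ (n m k : ℕ) (A : HlTOPL V m n k),
      ¬ ∃ (m' k' : ℕ) (B : HlTOPL V m' n k'), B.Lang = A.Langᶜ := by
  obtain ⟨x⟩ : Nonempty V := inferInstance
  refine ⟨1, 1, 3, HlTOPL.repetition x, fun ⟨m', k', B, hB⟩ => B.lang_ne_nodup ?_⟩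
  rw [hB, HlTOPL.lang_repetition, compl_compl]

end Topl
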